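/- Let ζ, η ∈ S_∞ be shape equivalent, and suppose u ≤_k ζu and x ≤_l ηx for some u, x ∈ S_∞ and k, l ∈ ℕ. Then ℓ(ζu) − ℓ(u) = ℓ(ηx) − ℓ(x); that is, the rank |ζ| depends only on the shape equivalence class of ζ. -/

import Mathlib

/-- A permutation of the positive integers belongs to `S_∞` when it moves only
finitely many points. -/
def FinSupp (w : Equiv.Perm ℕ+) : Prop := {x : ℕ+ | w x ≠ x}.Finite

/-- The length `ℓ(w)` of a permutation: its number of inversions, i.e. of pairs
`i < j` with `w i > w j`. -/
noncomputable def len (w : Equiv.Perm ℕ+) : ℕ :=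
  Set.ncard {p : ℕ+ × ℕ+ | p.1 < p.2 ∧ w p.2 < w p.1}

/-- Covering relation of the `k`-Bruhat order: `u ⋖_k u(a,b)` for `a ≤ k < b`
with `ℓ(u(a,b)) = ℓ(u) + 1`.  Here `u(a,b) = u * (swap a b)`. -/
def kBruhatCov (k : ℕ+) (u w : Equiv.Perm ℕ+) : Prop :=
  ∃ a b : ℕ+, a ≤ k ∧ k < b ∧ w = u * Equiv.swap a b ∧ len w = len u + 1

/-- The `k`-Bruhat order `u ≤_k w`: a chain of `k`-Bruhat covers from `u` to `w`
(or `u = w`). -/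
def kBruhat (k : ℕ+) : Equiv.Perm ℕ+ → Equiv.Perm ℕ+ → Prop :=
  Relation.ReflTransGen (kBruhatCov k)
/-- Permutations `ζ` and `η` are shape equivalent if there are sets
`P = {p_1 < ⋯ < p_n}` and `Q = {q_1 < ⋯ < q_n}` such that `ζ` fixes everything
outside `P`, `η` fixes everything outside `Q`, and `ζ(p_i) = p_j ↔ η(q_i) = q_j`. -/
def ShapeEquiv (ζ η : Equiv.Perm ℕ+) : Prop :=
  ∃ (n : ℕ) (p q : Fin n → ℕ+), StrictMono p ∧ StrictMono q ∧
    (∀ x : ℕ+, x ∉ Set.range p → ζ x = x) ∧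
    (∀ x : ℕ+, x ∉ Set.range q → η x = x) ∧
    (∀ i j : Fin n, ζ (p i) = p j ↔ η (q i) = q j)

open Finset

/-- The inversions of a permutation, as a set of pairs of positions. -/
def inversionSet (w : Equiv.Perm ℕ+) : Set (ℕ+ × ℕ+) :=
  {p | p.1 < p.2 ∧ w p.2 < w p.1}

theorem FinSupp.exists_bound {w : Equiv.Perm ℕ+} (hw : FinSupp w) :
    ∃ N : ℕ+, ∀ x, N < x → w x = x := by
  obtain ⟨N, hN⟩ := hw.bddAbove
  refine ⟨N, fun x hx => ?_⟩
  by_contra h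
  exact absurd (hN h) (not_le.mpr hx)

theorem apply_le_of_bound {w : Equiv.Perm ℕ+} {N : ℕ+} (hN : ∀ x, N < x → w x = x)
    {i : ℕ+} (hi : i ≤ N) : w i ≤ N := by
  by_contra! h
  have := w.injective (hN _ h)
  order

theorem sum_Iic_comp {w : Equiv.Perm ℕ+} {N : ℕ+} (hN : ∀ x, N < x → w x = x)
    (f : ℕ+ → ℤ) : ∑ i ∈ Iic N, f (w i) = ∑ i ∈ Iic N, f i := by
  refine Equiv.Perm.sum_comp w _ f fun x hx => ?_
  by_contra h
  exact hx (hN x (by simpa using h))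

theorem inversionSet_eq_filter {w : Equiv.Perm ℕ+} {N : ℕ+} (hN : ∀ x, N < x → w x = x) :
    inversionSet w = ((Iic N ×ˢ Iic N).filter fun p => p.1 < p.2 ∧ w p.2 < w p.1 :
      Finset (ℕ+ × ℕ+)) := by
  ext ⟨i, j⟩
  simp only [inversionSet, Set.mem_ofPred_eq, coe_filter, mem_product, mem_Iic]
  refine ⟨fun h => ⟨?_, h⟩, fun h => h.2⟩
  have hj : j ≤ N := by
    by_contra! hj
    have h1 := hN j hj
    rcases le_or_gt i N with hi | hi
    · have := apply_le_of_bound hN hi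
      order
    · have := hN i hi
      order
  exact ⟨h.1.le.trans hj, hj⟩

theorem FinSupp.finite_inversionSet {w : Equiv.Perm ℕ+} (hw : FinSupp w) :
    (inversionSet w).Finite := by
  obtain ⟨N, hN⟩ := hw.exists_bound
  rw [inversionSet_eq_filter hN]
  exact Finset.finite_toSet _

theorem len_eq_sum {w : Equiv.Perm ℕ+} {N : ℕ+} (hN : ∀ x, N < x → w x = x) :
    (len w : ℤ) = ∑ i ∈ Iic N, ∑ j ∈ Iic N, if i < j ∧ w j < w i then 1 else 0 := by
  have h : len w = (inversionSet w).ncard := rfl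
  rw [h, inversionSet_eq_filter hN, Set.ncard_coe_finset, ← Finset.sum_product',
    Finset.card_filter]
  push_cast
  rfl

theorem FinSupp.mul_swap {u : Equiv.Perm ℕ+} (hu : FinSupp u) (a b : ℕ+) :
    FinSupp (u * Equiv.swap a b) := by
  refine (hu.union (Set.toFinite {a, b})).subset fun x hx => ?_
  by_contra h
  simp only [Set.mem_union, Set.mem_ofPred_eq, Set.mem_insert_iff, Set.mem_singleton_iff,
    not_or, not_not] at h
  apply hx
  rw [Equiv.Perm.mul_apply, Equiv.swap_apply_of_ne_of_ne h.2.1 h.2.2, h.1]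

/-- Transport of a pair `i < j` along `swap a b`, leaving alone the pairs whose order the
transposition reverses. -/
def swapPair (a b : ℕ+) (p : ℕ+ × ℕ+) : ℕ+ × ℕ+ :=
  if Equiv.swap a b p.1 < Equiv.swap a b p.2 then
    (Equiv.swap a b p.1, Equiv.swap a b p.2) else p

theorem swapPair_swapPair {a b : ℕ+} {p : ℕ+ × ℕ+} (hp : p.1 < p.2) :
    swapPair a b (swapPair a b p) = p := by
  unfold swapPair
  by_cases h : Equiv.swap a b p.1 < Equiv.swap a b p.2
  · simp [h, hp]
  · simp [h]

theorem swapPair_mem_inversionSet {u : Equiv.Perm ℕ+} {a b : ℕ+} (hab : a < b)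
    (huab : u a < u b) {p : ℕ+ × ℕ+} (hp : p ∈ inversionSet u) :
    swapPair a b p ∈ inversionSet (u * Equiv.swap a b) := by
  obtain ⟨i, j⟩ := p
  obtain ⟨hij, hu⟩ := hp
  simp only at hij hu
  unfold swapPair inversionSet
  split_ifs with h
  · simpa using ⟨h, hu⟩
  · refine ⟨hij, ?_⟩
    simp only [Equiv.Perm.mul_apply, Equiv.swap_apply_def] at h ⊢
    split_ifs at h ⊢ <;> subst_vars <;> order

theorem len_add_card_le_len_mul_swap {u : Equiv.Perm ℕ+} (hu : FinSupp u) {a b : ℕ+}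
    (hab : a < b) (huab : u a < u b) (T : Finset (ℕ+ × ℕ+))
    (hT : ∀ p ∈ T, p ∈ inversionSet (u * Equiv.swap a b) ∧ p ∉ inversionSet u ∧
      swapPair a b p = p) :
    len u + #T ≤ len (u * Equiv.swap a b) := by
  have hinj : Set.InjOn (swapPair a b) (inversionSet u) := fun p hp q hq h => by
    rw [← swapPair_swapPair (a := a) (b := b) hp.1, h, swapPair_swapPair hq.1]
  have hdisj : Disjoint (swapPair a b '' inversionSet u) (T : Set (ℕ+ × ℕ+)) := by
    rw [Set.disjoint_left]
    rintro _ ⟨p, hp, rfl⟩ hpT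
    obtain ⟨-, hnot, hfix⟩ := hT _ hpT
    rw [swapPair_swapPair hp.1] at hfix
    exact hnot (hfix ▸ hp)
  have hsub : swapPair a b '' inversionSet u ∪ T ⊆ inversionSet (u * Equiv.swap a b) := by
    refine Set.union_subset ?_ fun p hp => (hT p hp).1
    rintro _ ⟨p, hp, rfl⟩
    exact swapPair_mem_inversionSet hab huab hp
  have h := Set.ncard_le_ncard hsub (hu.mul_swap a b).finite_inversionSet
  rwa [Set.ncard_union_eq hdisj (hu.finite_inversionSet.image _) T.finite_toSet,
    hinj.ncard_image, Set.ncard_coe_finset] at h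

theorem len_add_one_le_len_mul_swap {u : Equiv.Perm ℕ+} (hu : FinSupp u) {a b : ℕ+}
    (hab : a < b) (huab : u a < u b) : len u + 1 ≤ len (u * Equiv.swap a b) := by
  refine len_add_card_le_len_mul_swap hu hab huab {(a, b)} fun p hp => ?_
  obtain rfl := mem_singleton.mp hp
  simp [inversionSet, swapPair, hab, hab.le, huab, huab.le]

theorem len_add_two_le_len_mul_swap {u : Equiv.Perm ℕ+} (hu : FinSupp u) {a b c : ℕ+}
    (hac : a < c) (hcb : c < b) (huac : u a < u c) (hucb : u c < u b) :
    len u + 2 ≤ len (u * Equiv.swap a b) := by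
  have hab := hac.trans hcb
  have huab := huac.trans hucb
  have hc : Equiv.swap a b c = c := Equiv.swap_apply_of_ne_of_ne hac.ne' hcb.ne
  rw [← card_pair (a := (a, b)) (b := (a, c)) (by simp [hcb.ne'])]
  refine len_add_card_le_len_mul_swap hu hab huab _ fun p hp => ?_
  rcases mem_insert.mp hp with rfl | hp
  · simp [inversionSet, swapPair, hab, hab.le, huab, huab.le]
  · obtain rfl := mem_singleton.mp hp
    simp [inversionSet, swapPair, hc, hac, hcb.not_gt, hucb, huac.le]

/-- The order relations between `u` and `w` forced by `u ≤_k w`. -/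
structure BruhatCompatible (k : ℕ+) (u w : Equiv.Perm ℕ+) : Prop where
  le_apply : ∀ i, i ≤ k → u i ≤ w i
  apply_le : ∀ i, k < i → w i ≤ u i
  lt_of_lt : ∀ i j, i < j → (j ≤ k ∨ k < i) → u i < u j → w i < w j

theorem kBruhatCov.bruhatCompatible {k : ℕ+} {u w : Equiv.Perm ℕ+} (hu : FinSupp u)
    (h : kBruhatCov k u w) : BruhatCompatible k u w := by
  obtain ⟨a, b, hak, hkb, rfl, hlen⟩ := h
  have hab : a < b := hak.trans_lt hkb
  have huab : u a < u b := by
    by_contra! hle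
    have hlt : u b < u a := lt_of_le_of_ne hle (u.injective.ne hab.ne')
    have := len_add_one_le_len_mul_swap (hu.mul_swap a b) hab (by simpa using hlt)
    rw [mul_assoc, Equiv.swap_mul_self, mul_one] at this
    omega
  have hgap : ∀ c, a < c → c < b → u a < u c → u b ≤ u c := fun c hac hcb huac => by
    by_contra! hucb
    have := len_add_two_le_len_mul_swap hu hac hcb huac hucb
    omega
  refine ⟨fun i hi => ?_, fun i hi => ?_, fun i j hij hk h => ?_⟩
  · simp only [Equiv.Perm.mul_apply, Equiv.swap_apply_def]
    split_ifs <;> subst_vars <;> order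
  · simp only [Equiv.Perm.mul_apply, Equiv.swap_apply_def]
    split_ifs <;> subst_vars <;> order
  · have hne := fun x y (hxy : x ≠ y) => u.injective.ne hxy
    simp only [Equiv.Perm.mul_apply, Equiv.swap_apply_def]
    grind

theorem kBruhat.bruhatCompatible {k : ℕ+} {u w : Equiv.Perm ℕ+} (hu : FinSupp u)
    (h : kBruhat k u w) : BruhatCompatible k u w := by
  suffices FinSupp w ∧ BruhatCompatible k u w from this.2
  induction h with
  | refl => exact ⟨hu, fun _ _ => le_rfl, fun _ _ => le_rfl, fun _ _ _ _ h => h⟩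
  | tail _ hcov ih =>
    obtain ⟨hv, h₁⟩ := ih
    have h₂ := hcov.bruhatCompatible hv
    refine ⟨?_, fun i hi => (h₁.le_apply i hi).trans (h₂.le_apply i hi),
      fun i hi => (h₂.apply_le i hi).trans (h₁.apply_le i hi),
      fun i j hij hk h => h₂.lt_of_lt i j hij hk (h₁.lt_of_lt i j hij hk h)⟩
    obtain ⟨a, b, -, -, rfl, -⟩ := hcov
    exact hv.mul_swap a b

/-- The indicator of the inversions of `ζ`. -/
def invInd (ζ : Equiv.Perm ℕ+) (α β : ℕ+) : ℤ := if α < β ∧ ζ β < ζ α then 1 else 0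

/-- The direction in which `ζ` moves `α`. -/
def moveSign (ζ : Equiv.Perm ℕ+) (α : ℕ+) : ℤ :=
  if α < ζ α then 1 else if ζ α < α then -1 else 0

/-- The sign telling on which side of `k` a position lies. -/
def sideSign (k i : ℕ+) : ℤ := if i ≤ k then 1 else -1

theorem BruhatCompatible.inversion_change {k : ℕ+} {u w : Equiv.Perm ℕ+}
    (h : BruhatCompatible k u w) {i j : ℕ+} (hij : i < j) :
    ((if i < j ∧ w j < w i then 1 else 0) - (if i < j ∧ u j < u i then 1 else 0) +
        (if u i < u j ∧ w j < w i then 1 else 0) * (sideSign k i * sideSign k j)) +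
      ((if j < i ∧ w i < w j then 1 else 0) - (if j < i ∧ u i < u j then 1 else 0) +
        (if u j < u i ∧ w i < w j then 1 else 0) * (sideSign k j * sideSign k i)) = 0 := by
  have hu : u i ≠ u j := u.injective.ne hij.ne
  have hw : w i ≠ w j := w.injective.ne hij.ne
  have hi₁ := h.le_apply i
  have hi₂ := h.apply_le i
  have hj₁ := h.le_apply j
  have hj₂ := h.apply_le j
  have hlt := h.lt_of_lt i j hij
  unfold sideSign
  rcases lt_or_gt_of_ne hu with hu | hu <;> rcases lt_or_gt_of_ne hw with hw | hw <;>
    rcases le_or_gt i k with hi | hi <;> rcases le_or_gt j k with hj | hj <;>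
    simp only [hij, hij.not_gt, hu, hw, hu.not_gt, hw.not_gt, if_true, if_false, and_true,
      and_false] <;> grind

theorem BruhatCompatible.len_sub_len {k N : ℕ+} {ζ u : Equiv.Perm ℕ+}
    (h : BruhatCompatible k u (ζ * u)) (hζ : ∀ x, N < x → ζ x = x)
    (hu : ∀ x, N < x → u x = x) :
    (len (ζ * u) : ℤ) - len u = -∑ α ∈ Iic N, ∑ β ∈ Iic N,
      invInd ζ α β * (sideSign k (u⁻¹ α) * sideSign k (u⁻¹ β)) := by
  have hw : ∀ x, N < x → (ζ * u) x = x := fun x hx => by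
    rw [Equiv.Perm.mul_apply, hu x hx, hζ x hx]
  have hre : ∑ α ∈ Iic N, ∑ β ∈ Iic N,
      invInd ζ α β * (sideSign k (u⁻¹ α) * sideSign k (u⁻¹ β)) =
      ∑ i ∈ Iic N, ∑ j ∈ Iic N,
        invInd ζ (u i) (u j) * (sideSign k i * sideSign k j) := by
    rw [← sum_Iic_comp hu]
    refine sum_congr rfl fun i _ => ?_
    rw [← sum_Iic_comp hu]
    simp
  rw [hre, len_eq_sum hw, len_eq_sum hu, ← sum_neg_distrib, ← sum_sub_distrib]
  simp_rw [← sum_neg_distrib, ← sum_sub_distrib]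
  set A : ℕ+ → ℕ+ → ℤ := fun i j => ((if i < j ∧ (ζ * u) j < (ζ * u) i then 1 else 0) -
      (if i < j ∧ u j < u i then 1 else 0)) +
      invInd ζ (u i) (u j) * (sideSign k i * sideSign k j) with hA
  have hanti : ∀ i j, A i j + A j i = 0 := fun i j => by
    rcases lt_trichotomy i j with hij | rfl | hij
    · exact h.inversion_change hij
    · simp [hA, invInd]
    · rw [add_comm]
      exact h.inversion_change hij
  have hzero : ∑ i ∈ Iic N, ∑ j ∈ Iic N, A i j = 0 := by
    have h1 : ∑ i ∈ Iic N, ∑ j ∈ Iic N, A i j + ∑ i ∈ Iic N, ∑ j ∈ Iic N, A j i = 0 := by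
      simp_rw [← sum_add_distrib, hanti, sum_const_zero]
    have h2 := sum_comm (s := Iic N) (t := Iic N) (f := A)
    omega
  rw [← sub_eq_zero]
  simp_rw [← sum_sub_distrib, sub_neg_eq_add]
  exact hzero

theorem sum_invInd_mul_moveSign_of_fixed {ζ : Equiv.Perm ℕ+} {N γ : ℕ+}
    (hζ : ∀ x, N < x → ζ x = x) (hγ : ζ γ = γ) :
    ∑ α ∈ Iic N, (invInd ζ α γ + invInd ζ γ α) * moveSign ζ α = 0 := by
  have h : ∀ α, (invInd ζ α γ + invInd ζ γ α) * moveSign ζ α =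
      (if γ < ζ α then 1 else 0) - (if γ < α then 1 else 0) := fun α => by
    have h1 : ζ α = γ → α = γ := fun h => ζ.injective (h.trans hγ.symm)
    unfold invInd moveSign
    rw [hγ]
    split_ifs <;> grind
  simp_rw [h, sum_sub_distrib]
  rw [sum_Iic_comp hζ fun α => if γ < α then 1 else 0, sub_self]

theorem sum_invInd_congr {ζ : Equiv.Perm ℕ+} {N : ℕ+} (hζ : ∀ x, N < x → ζ x = x)
    {ε : ℕ+ → ℤ} (hε : ∀ α, ζ α ≠ α → ε α = moveSign ζ α) :
    ∑ α ∈ Iic N, ∑ β ∈ Iic N, invInd ζ α β * (ε α * ε β) =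
      ∑ α ∈ Iic N, ∑ β ∈ Iic N, invInd ζ α β * (moveSign ζ α * moveSign ζ β) := by
  set τ : ℕ+ → ℤ := fun α => ε α - moveSign ζ α with hτ
  have hτ0 : ∀ α, ζ α ≠ α → τ α = 0 := fun α h => by simp [hτ, hε α h]
  have hττ : ∀ α β, invInd ζ α β * (τ α * τ β) = 0 := fun α β => by
    by_cases hα : ζ α = α
    · by_cases hβ : ζ β = β
      · have : invInd ζ α β = 0 := by
          unfold invInd
          rw [hα, hβ, if_neg fun h => absurd h.1 (not_lt.mpr h.2.le)]
        rw [this, zero_mul]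
      · rw [hτ0 β hβ]; ring
    · rw [hτ0 α hα]; ring
  have hcross : ∑ β ∈ Iic N, ∑ α ∈ Iic N,
      (invInd ζ α β + invInd ζ β α) * moveSign ζ α * τ β = 0 := by
    refine sum_eq_zero fun β _ => ?_
    rw [← sum_mul]
    by_cases hβ : ζ β = β
    · rw [sum_invInd_mul_moveSign_of_fixed hζ hβ, zero_mul]
    · rw [hτ0 β hβ, mul_zero]
  have hsplit : ∀ α β, invInd ζ α β * (ε α * ε β) =
      invInd ζ α β * (moveSign ζ α * moveSign ζ β) + invInd ζ α β * moveSign ζ α * τ β +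
        invInd ζ α β * moveSign ζ β * τ α := fun α β => by
    have := hττ α β
    simp only [hτ] at this ⊢
    linear_combination this
  simp_rw [hsplit, sum_add_distrib]
  simp_rw [add_mul, sum_add_distrib] at hcross
  rw [sum_comm] at hcross
  rw [add_assoc, hcross, add_zero]

theorem BruhatCompatible.len_sub_len_eq_moveSign {k N : ℕ+} {ζ u : Equiv.Perm ℕ+}
    (h : BruhatCompatible k u (ζ * u)) (hζ : ∀ x, N < x → ζ x = x)
    (hu : ∀ x, N < x → u x = x) :
    (len (ζ * u) : ℤ) - len u = -∑ α ∈ Iic N, ∑ β ∈ Iic N,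
      invInd ζ α β * (moveSign ζ α * moveSign ζ β) := by
  rw [h.len_sub_len hζ hu,
    sum_invInd_congr hζ (ε := fun α => sideSign k (u⁻¹ α)) fun α hα => ?_]
  obtain ⟨i, rfl⟩ := u.surjective α
  have h1 := h.le_apply i
  have h2 := h.apply_le i
  simp only [Equiv.Perm.mul_apply] at h1 h2
  have hi : u⁻¹ (u i) = i := u.symm_apply_apply i
  simp only [hi, sideSign, moveSign]
  split_ifs <;> grind

theorem sum_moveSign_eq_sum_fin {ζ : Equiv.Perm ℕ+} {n : ℕ} {p : Fin n → ℕ+}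
    (hp : StrictMono p) (hfix : ∀ x, x ∉ Set.range p → ζ x = x) {N : ℕ+}
    (hN : ∀ i, p i ≤ N) :
    ∑ α ∈ Iic N, ∑ β ∈ Iic N, invInd ζ α β * (moveSign ζ α * moveSign ζ β) =
      ∑ i, ∑ j, invInd ζ (p i) (p j) * (moveSign ζ (p i) * moveSign ζ (p j)) := by
  have hsum : ∀ f : ℕ+ → ℤ, (∀ x, x ∉ Set.range p → f x = 0) →
      ∑ x ∈ Iic N, f x = ∑ i, f (p i) := fun f hf => by
    rw [← sum_image (f := f) (g := p) hp.injective.injOn]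
    refine (sum_subset (fun x hx => ?_) fun x _ hx => hf x (by simpa using hx)).symm
    obtain ⟨i, -, rfl⟩ := mem_image.mp hx
    exact mem_Iic.mpr (hN i)
  have h0 : ∀ x, x ∉ Set.range p → moveSign ζ x = 0 := fun x hx => by
    simp [moveSign, hfix x hx]
  rw [hsum _ fun x hx => by simp [h0 x hx]]
  exact sum_congr rfl fun i _ => hsum _ fun x hx => by simp [h0 x hx]

theorem apply_mem_range {ζ : Equiv.Perm ℕ+} {n : ℕ} {p : Fin n → ℕ+}
    (hfix : ∀ x, x ∉ Set.range p → ζ x = x) (i : Fin n) : ∃ j, ζ (p i) = p j := by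
  by_contra! h
  have h1 : ζ (p i) ∉ Set.range p := fun ⟨j, hj⟩ => h j hj.symm
  exact h i (ζ.injective (hfix _ h1))


/-- If `ζ` and `η` are shape equivalent, `u ≤_k ζu` and `x ≤_l ηx`, then
`ℓ(ζu) - ℓ(u) = ℓ(ηx) - ℓ(x)`; the rank `|ζ|` depends only on the shape
equivalence class of `ζ`. -/
theorem stmt_19 (ζ η u x : Equiv.Perm ℕ+) (k l : ℕ+)
    (hζ : FinSupp ζ) (hη : FinSupp η) (hu : FinSupp u) (hx : FinSupp x)
    (hse : ShapeEquiv ζ η)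
    (h₁ : kBruhat k u (ζ * u)) (h₂ : kBruhat l x (η * x)) :
    (len (ζ * u) : ℤ) - (len u : ℤ) = (len (η * x) : ℤ) - (len x : ℤ) := by
  obtain ⟨n, p, q, hp, hq, hpfix, hqfix, hpq⟩ := hse
  choose σ hσ using apply_mem_range hpfix
  have hσ' : ∀ i, η (q i) = q (σ i) := fun i => (hpq i (σ i)).mp (hσ i)
  have key : ∀ {ξ v : Equiv.Perm ℕ+} {m : ℕ+} {r : Fin n → ℕ+}, FinSupp ξ → FinSupp v →
      kBruhat m v (ξ * v) → StrictMono r → (∀ y, y ∉ Set.range r → ξ y = y) →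
      (∀ i, ξ (r i) = r (σ i)) →
      (len (ξ * v) : ℤ) - len v = -∑ i, ∑ j, (if i < j ∧ σ j < σ i then 1 else 0) *
        ((if i < σ i then 1 else if σ i < i then -1 else 0) *
          (if j < σ j then 1 else if σ j < j then -1 else 0)) := by
    intro ξ v m r hξ hv h hr hfix hσr
    obtain ⟨N₁, hN₁⟩ := hξ.exists_bound
    obtain ⟨N₂, hN₂⟩ := hv.exists_bound
    obtain ⟨N₃, hN₃⟩ := (Set.finite_range r).bddAbove
    have hle₁ : N₁ ≤ N₁ ⊔ (N₂ ⊔ N₃) := le_sup_left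
    have hle₂ : N₂ ≤ N₁ ⊔ (N₂ ⊔ N₃) := le_sup_left.trans le_sup_right
    have hle₃ : N₃ ≤ N₁ ⊔ (N₂ ⊔ N₃) := le_sup_right.trans le_sup_right
    rw [(h.bruhatCompatible hv).len_sub_len_eq_moveSign (N := N₁ ⊔ (N₂ ⊔ N₃))
        (fun y hy => hN₁ y (hle₁.trans_lt hy)) (fun y hy => hN₂ y (hle₂.trans_lt hy)),
      sum_moveSign_eq_sum_fin hr hfix fun i => (hN₃ ⟨i, rfl⟩).trans hle₃]
    simp only [invInd, moveSign, hσr, hr.lt_iff_lt]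
  rw [key hζ hu h₁ hp hpfix hσ, key hη hx h₂ hq hqfix hσ']
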